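/- Let p ∈ [1,∞), and suppose R_n, R, T_n, T ∈ B(H) with R_n → R and T_n → T in the strong operator topology, and S_n, S lie in the Schatten p-class with ‖S_n - S‖_{B_p} → 0. Then ‖R_n S_n T_n* - R S T*‖_{B_p} → 0 as n → ∞. -/

import Mathlib

open Filter

/-- The `n`-th approximation number of a bounded operator `T` on a Hilbert space:
the distance from `T` to operators of rank at most `n`.  For compact operators on a
Hilbert space these coincide with the singular values. -/
noncomputable def approxNumber {H : Type*} [NormedAddCommGroup H] [InnerProductSpace ℂ H]
    (n : ℕ) (T : H →L[ℂ] H) : ℝ :=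
  sInf {c : ℝ | ∃ F : H →L[ℂ] H,
    FiniteDimensional ℂ (LinearMap.range (F : H →ₗ[ℂ] H)) ∧
    Module.finrank ℂ (LinearMap.range (F : H →ₗ[ℂ] H)) ≤ n ∧ c = ‖T - F‖}

/-- Membership in the Schatten `p`-class `B_p(H)`, `p ∈ [1,∞)`, defined via summability of
the `p`-th powers of the approximation numbers (= singular values). -/
def MemSchatten {H : Type*} [NormedAddCommGroup H] [InnerProductSpace ℂ H]
    (p : ℝ) (T : H →L[ℂ] H) : Prop :=
  IsCompactOperator T ∧ Summable (fun n => approxNumber n T ^ p)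

/-- The Schatten `p`-norm `‖T‖_{B_p} = (∑ₙ sₙ(T)^p)^{1/p}`. -/
noncomputable def schattenNorm {H : Type*} [NormedAddCommGroup H] [InnerProductSpace ℂ H]
    (p : ℝ) (T : H →L[ℂ] H) : ℝ :=
  (∑' n, approxNumber n T ^ p) ^ (1 / p)


namespace SchattenAux

variable {H : Type*} [NormedAddCommGroup H] [InnerProductSpace ℂ H]

lemma rank_le_iff (F : H →L[ℂ] H) (n : ℕ) :
    (FiniteDimensional ℂ (LinearMap.range (F : H →ₗ[ℂ] H)) ∧
      Module.finrank ℂ (LinearMap.range (F : H →ₗ[ℂ] H)) ≤ n) ↔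
    LinearMap.rank (F : H →ₗ[ℂ] H) ≤ n := by
  constructor
  · rintro ⟨h1, h2⟩
    rw [LinearMap.rank, ← Module.finrank_eq_rank]
    exact_mod_cast h2
  · intro h
    exact ⟨Module.rank_lt_aleph0_iff.1 (lt_of_le_of_lt h (Cardinal.natCast_lt_aleph0)),
      Module.finrank_le_of_rank_le h⟩

lemma approx_le (n : ℕ) (T F : H →L[ℂ] H) (h : LinearMap.rank (F : H →ₗ[ℂ] H) ≤ n) :
    approxNumber n T ≤ ‖T - F‖ := by
  refine csInf_le ⟨0, ?_⟩ ?_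
  · rintro c ⟨F, -, -, rfl⟩
    exact norm_nonneg _
  · obtain ⟨h1, h2⟩ := (rank_le_iff F n).2 h
    exact ⟨F, h1, h2, rfl⟩

lemma rank_zero_le (n : ℕ) : LinearMap.rank ((0 : H →L[ℂ] H) : H →ₗ[ℂ] H) ≤ n := by
  simp [LinearMap.rank_zero]

lemma le_approx (n : ℕ) (T : H →L[ℂ] H) (c : ℝ)
    (h : ∀ F : H →L[ℂ] H, LinearMap.rank (F : H →ₗ[ℂ] H) ≤ n → c ≤ ‖T - F‖) :
    c ≤ approxNumber n T := by
  refine le_csInf ?_ ?_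
  · obtain ⟨h1, h2⟩ := (rank_le_iff (0 : H →L[ℂ] H) n).2 (rank_zero_le n)
    exact ⟨_, 0, h1, h2, rfl⟩
  · rintro c ⟨F, h1, h2, rfl⟩
    exact h F ((rank_le_iff F n).1 ⟨h1, h2⟩)

lemma approx_nonneg (n : ℕ) (T : H →L[ℂ] H) : 0 ≤ approxNumber n T :=
  le_approx n T 0 fun _ _ => norm_nonneg _

lemma approx_le_norm (n : ℕ) (T : H →L[ℂ] H) : approxNumber n T ≤ ‖T‖ := by
  simpa using approx_le n T 0 (rank_zero_le n)

lemma approx_anti {m n : ℕ} (h : m ≤ n) (T : H →L[ℂ] H) :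
    approxNumber n T ≤ approxNumber m T :=
  le_approx m T _ fun F hF => approx_le n T F (hF.trans (by exact_mod_cast h))

lemma approx_add (m n : ℕ) (A B : H →L[ℂ] H) :
    approxNumber (m + n) (A + B) ≤ approxNumber m A + approxNumber n B := by
  rw [← sub_le_iff_le_add]
  refine le_approx m A _ fun F hF => ?_
  rw [sub_le_comm]
  refine le_approx n B _ fun G hG => ?_
  rw [sub_le_iff_le_add]
  have h1 : LinearMap.rank ((F + G : H →L[ℂ] H) : H →ₗ[ℂ] H) ≤ ((m + n : ℕ) : Cardinal) := by
    refine (LinearMap.rank_add_le _ _).trans ?_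
    push_cast
    exact add_le_add hF hG
  refine (approx_le _ (A + B) (F + G) h1).trans ?_
  rw [add_sub_add_comm, add_comm]
  refine (norm_add_le _ _).trans (le_of_eq (add_comm _ _)) |>.trans ?_
  rw [add_comm]

lemma approx_mul (n : ℕ) (R S T : H →L[ℂ] H) {C D : ℝ} (hC : 0 < C) (hD : 0 < D)
    (hR : ‖R‖ ≤ C) (hT : ‖T‖ ≤ D) :
    approxNumber n (R * S * T) ≤ C * D * approxNumber n S := by
  rw [← div_le_iff₀' (by positivity)]
  refine le_approx n S _ fun F hF => ?_
  rw [div_le_iff₀' (by positivity)]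
  have h1 : LinearMap.rank ((R * F * T : H →L[ℂ] H) : H →ₗ[ℂ] H) ≤ n := by
    refine (LinearMap.rank_comp_le_left (T : H →ₗ[ℂ] H) ((R * F : H →L[ℂ] H) : H →ₗ[ℂ] H)).trans ?_
    exact (LinearMap.rank_comp_le_right (F : H →ₗ[ℂ] H) (R : H →ₗ[ℂ] H)).trans hF
  refine (approx_le n _ _ h1).trans ?_
  have h2 : R * S * T - R * F * T = R * (S - F) * T := by noncomm_ring
  rw [h2]
  calc ‖R * (S - F) * T‖ ≤ ‖R‖ * ‖S - F‖ * ‖T‖ :=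
        (norm_mul_le _ _).trans (by gcongr; exact norm_mul_le _ _)
    _ ≤ C * ‖S - F‖ * D := by gcongr
    _ = _ := by ring

lemma approx_neg (n : ℕ) (S : H →L[ℂ] H) : approxNumber n (-S) ≤ approxNumber n S := by
  have := approx_mul n (-1) S 1 (C := 1) (D := 1) one_pos one_pos
    (by rw [norm_neg]; exact ContinuousLinearMap.norm_id_le) ContinuousLinearMap.norm_id_le
  simpa using this

lemma approx_add_half (j : ℕ) (A B : H →L[ℂ] H) :
    approxNumber j (A + B) ≤ approxNumber (j / 2) A + approxNumber (j / 2) B :=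
  (approx_anti (by omega) _).trans (approx_add (j / 2) (j / 2) A B)

lemma approx_sub_half (j : ℕ) (A B : H →L[ℂ] H) :
    approxNumber j (A - B) ≤ approxNumber (j / 2) A + approxNumber (j / 2) B := by
  rw [sub_eq_add_neg]
  exact (approx_add_half j A (-B)).trans (by gcongr; exact approx_neg _ _)

lemma hasSum_half {f : ℕ → ℝ} {a : ℝ} (h : HasSum f a) : HasSum (fun j => f (j / 2)) (a + a) := by
  refine HasSum.even_add_odd ?_ ?_
  · simpa using h
  · have : ∀ k, (2 * k + 1) / 2 = k := fun k => by omega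
    simpa [this] using h

lemma add_rpow_le {a b p : ℝ} (ha : 0 ≤ a) (hb : 0 ≤ b) (hp : 1 ≤ p) :
    (a + b) ^ p ≤ 2 ^ (p - 1) * (a ^ p + b ^ p) := by
  lift a to NNReal using ha
  lift b to NNReal using hb
  exact_mod_cast NNReal.rpow_add_le_mul_rpow_add_rpow a b hp

/-- Summability and bound for the sum. -/
lemma sum_bound {p : ℝ} (hp : 1 ≤ p) {a b c : ℕ → ℝ} (ha : ∀ n, 0 ≤ a n) (hb : ∀ n, 0 ≤ b n)
    (hc : ∀ n, 0 ≤ c n)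
    (h : ∀ j, c j ≤ a (j / 2) + b (j / 2)) (hsa : Summable fun n => a n ^ p)
    (hsb : Summable fun n => b n ^ p) :
    Summable (fun n => c n ^ p) ∧
      ∑' n, c n ^ p ≤ 2 ^ p * (∑' n, a n ^ p + ∑' n, b n ^ p) := by
  have h1 := (hasSum_half (hsa.hasSum.add hsb.hasSum)).mul_left ((2 : ℝ) ^ (p - 1))
  have h2 : ∀ j, c j ^ p ≤ 2 ^ (p - 1) * (a (j / 2) ^ p + b (j / 2) ^ p) := fun j =>
    (Real.rpow_le_rpow (hc j) (h j) (by linarith)).trans (add_rpow_le (ha _) (hb _) hp)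
  have h3 : Summable (fun n => c n ^ p) :=
    Summable.of_nonneg_of_le (fun n => Real.rpow_nonneg (hc n) p) h2 h1.summable
  refine ⟨h3, (h3.tsum_le_tsum h2 h1.summable).trans (le_of_eq ?_)⟩
  rw [h1.tsum_eq, Real.rpow_sub_one two_ne_zero]
  ring

/-- Norm-approximable by finite sums of rank one operators. -/
def FinApprox (S : H →L[ℂ] H) : Prop :=
  ∀ ε > 0, ∃ (m : ℕ) (u v : Fin m → H),
    ‖S - ∑ i, InnerProductSpace.rankOne ℂ (u i) (v i)‖ < ε

variable [CompleteSpace H]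

lemma finApprox_adjoint {S : H →L[ℂ] H} (h : FinApprox S) :
    FinApprox (ContinuousLinearMap.adjoint S) := by
  intro ε hε
  obtain ⟨m, u, v, huv⟩ := h ε hε
  refine ⟨m, v, u, ?_⟩
  rw [← LinearIsometryEquiv.norm_map ContinuousLinearMap.adjoint] at huv
  simpa [map_sub, map_sum] using huv

lemma exists_rankOne (F : H →L[ℂ] H) (n : ℕ) (hF : LinearMap.rank (F : H →ₗ[ℂ] H) ≤ n) :
    ∃ (m : ℕ) (u v : Fin m → H), F = ∑ i, InnerProductSpace.rankOne ℂ (u i) (v i) := by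
  obtain ⟨h1, h2⟩ := (rank_le_iff F n).2 hF
  let b := stdOrthonormalBasis ℂ (LinearMap.range (F : H →ₗ[ℂ] H))
  refine ⟨_, fun i => (b i : H), fun i => ContinuousLinearMap.adjoint F (b i), ?_⟩
  ext x
  have := congrArg Subtype.val (b.sum_repr' ⟨F x, ⟨x, rfl⟩⟩)
  simp only [Submodule.coe_sum, Submodule.coe_smul, Submodule.coe_inner] at this
  simp [ContinuousLinearMap.sum_apply, ContinuousLinearMap.adjoint_inner_left, this]

lemma finApprox_of_summable {p : ℝ} (hp : 1 ≤ p) {S : H →L[ℂ] H}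
    (h : Summable fun n => approxNumber n S ^ p) : FinApprox S := by
  intro ε hε
  have h0 := h.tendsto_atTop_zero
  obtain ⟨n, hn⟩ := (h0.eventually (gt_mem_nhds (Real.rpow_pos_of_pos hε p))).exists
  have hlt : approxNumber n S < ε :=
    (Real.rpow_lt_rpow_iff (approx_nonneg _ _) hε.le (by linarith)).1 hn
  by_contra hcon
  push Not at hcon
  refine absurd hlt (not_lt.2 (le_approx n S ε fun F hF => ?_))
  obtain ⟨m, u, v, rfl⟩ := exists_rankOne F n hF
  exact hcon m u v

lemma tendsto_mul_zero {S : H →L[ℂ] H} (h : FinApprox S) (A : ℕ → H →L[ℂ] H) {C : ℝ}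
    (hC : 0 < C) (hA : ∀ n, ‖A n‖ ≤ C) (hA0 : ∀ x, Tendsto (fun n => A n x) atTop (nhds 0)) :
    Tendsto (fun n => ‖A n * S‖) atTop (nhds 0) := by
  rw [Metric.tendsto_atTop']
  intro ε hε
  obtain ⟨m, u, v, huv⟩ := h (ε / (2 * C)) (by positivity)
  have h1 : Tendsto (fun n => ∑ i, ‖A n (u i)‖ * ‖v i‖) atTop (nhds 0) := by
    have : Tendsto (fun n => ∑ i, ‖A n (u i)‖ * ‖v i‖) atTop (nhds (∑ i, 0 * ‖v i‖)) :=
      tendsto_finsetSum _ fun i _ => by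
        have := (hA0 (u i)).norm
        rw [norm_zero] at this
        exact this.mul_const _
    simpa using this
  obtain ⟨N, hN⟩ := eventually_atTop.1 (h1.eventually (gt_mem_nhds (half_pos hε)))
  refine ⟨N, fun n hn => ?_⟩
  rw [Real.dist_eq, sub_zero, abs_of_nonneg (norm_nonneg _)]
  have h2 : A n * S = A n * (S - ∑ i, InnerProductSpace.rankOne ℂ (u i) (v i)) +
      ∑ i, InnerProductSpace.rankOne ℂ (A n (u i)) (v i) := by
    ext x
    simp [ContinuousLinearMap.sum_apply, map_sum]
  rw [h2]
  have h3 : ‖A n * (S - ∑ i, InnerProductSpace.rankOne ℂ (u i) (v i))‖ ≤ C * (ε / (2 * C)) :=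
    (norm_mul_le _ _).trans (mul_le_mul (hA n) huv.le (norm_nonneg _) hC.le)
  have h4 : C * (ε / (2 * C)) = ε / 2 := by field_simp
  have h5 : ‖∑ i, InnerProductSpace.rankOne ℂ (A n (u i)) (v i)‖ ≤ ∑ i, ‖A n (u i)‖ * ‖v i‖ :=
    (norm_sum_le _ _).trans (Finset.sum_le_sum fun i _ => by simp)
  have h6 := hN n hn.le
  linarith [norm_add_le (A n * (S - ∑ i, InnerProductSpace.rankOne ℂ (u i) (v i)))
    (∑ i, InnerProductSpace.rankOne ℂ (A n (u i)) (v i))]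

lemma exists_bound (R : ℕ → H →L[ℂ] H) (Rl : H →L[ℂ] H)
    (hR : ∀ x : H, Tendsto (fun n => R n x) atTop (nhds (Rl x))) :
    ∃ C, 0 < C ∧ (∀ n, ‖R n‖ ≤ C) ∧ ‖Rl‖ ≤ C := by
  obtain ⟨C, hC⟩ := banach_steinhaus (g := R) fun x => by
    obtain ⟨c, hc⟩ := (hR x).norm.bddAbove_range
    exact ⟨c, fun n => hc ⟨n, rfl⟩⟩
  refine ⟨max (max C ‖Rl‖) 1, by positivity, fun n => ?_, ?_⟩
  · exact (hC n).trans ((le_max_left _ _).trans (le_max_left _ _))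
  · exact (le_max_right _ _).trans (le_max_left _ _)

end SchattenAux

open SchattenAux in
/-- If `Rₙ → R` and `Tₙ → T` strongly, and `‖Sₙ - S‖_{B_p} → 0` with all `Sₙ, S ∈ B_p(H)`,
then `‖Rₙ Sₙ Tₙ* - R S T*‖_{B_p} → 0`. -/
theorem schatten_norm_tendsto_of_strong_tendsto
    {H : Type*} [NormedAddCommGroup H] [InnerProductSpace ℂ H] [CompleteSpace H]
    (p : ℝ) (hp : 1 ≤ p)
    (R T S : ℕ → H →L[ℂ] H) (Rl Tl Sl : H →L[ℂ] H)
    (hR : ∀ x : H, Tendsto (fun n => R n x) atTop (nhds (Rl x)))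
    (hT : ∀ x : H, Tendsto (fun n => T n x) atTop (nhds (Tl x)))
    (hSmem : ∀ n, MemSchatten p (S n)) (hSlmem : MemSchatten p Sl)
    (hS : Tendsto (fun n => schattenNorm p (S n - Sl)) atTop (nhds 0)) :
    Tendsto (fun n =>
        schattenNorm p (R n * S n * ContinuousLinearMap.adjoint (T n) -
          Rl * Sl * ContinuousLinearMap.adjoint Tl)) atTop (nhds 0) := by
  have hp0 : 0 < p := by linarith
  obtain ⟨C, hC, hRC, hRlC⟩ := exists_bound R Rl hR
  obtain ⟨D, hD, hTD, hTlD⟩ := exists_bound T Tl hT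
  have hTD' : ∀ n, ‖ContinuousLinearMap.adjoint (T n)‖ ≤ D := fun n => by
    rw [LinearIsometryEquiv.norm_map]; exact hTD n
  have hTlD' : ‖ContinuousLinearMap.adjoint Tl‖ ≤ D := by
    rw [LinearIsometryEquiv.norm_map]; exact hTlD
  -- the remainder with `S` fixed
  set X : ℕ → H →L[ℂ] H := fun n => R n * Sl * ContinuousLinearMap.adjoint (T n) -
    Rl * Sl * ContinuousLinearMap.adjoint Tl with hX
  have hfin : FinApprox Sl := finApprox_of_summable hp hSlmem.2
  have hXnorm : Tendsto (fun n => ‖X n‖) atTop (nhds 0) := by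
    have h1 : Tendsto (fun n => ‖(R n - Rl) * Sl‖) atTop (nhds 0) := by
      refine tendsto_mul_zero hfin _ (C := C + C) (by positivity) (fun n => ?_) fun x => ?_
      · exact (norm_sub_le _ _).trans (add_le_add (hRC n) hRlC)
      · simpa using (hR x).sub_const (Rl x)
    have h2 : Tendsto (fun n => ‖(T n - Tl) * ContinuousLinearMap.adjoint Sl‖) atTop (nhds 0) := by
      refine tendsto_mul_zero (finApprox_adjoint hfin) _ (C := D + D) (by positivity)
        (fun n => ?_) fun x => ?_
      · exact (norm_sub_le _ _).trans (add_le_add (hTD n) hTlD)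
      · simpa using (hT x).sub_const (Tl x)
    have h3 : Tendsto (fun n => ‖(R n - Rl) * Sl‖ * D +
        C * ‖(T n - Tl) * ContinuousLinearMap.adjoint Sl‖) atTop (nhds 0) := by
      simpa using (h1.mul_const D).add (h2.const_mul C)
    refine squeeze_zero (fun _ => norm_nonneg _) (fun n => ?_) h3
    have h4 : ‖Sl * (ContinuousLinearMap.adjoint (T n) - ContinuousLinearMap.adjoint Tl)‖ =
        ‖(T n - Tl) * ContinuousLinearMap.adjoint Sl‖ := by
      rw [← LinearIsometryEquiv.norm_map ContinuousLinearMap.adjoint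
        ((T n - Tl) * ContinuousLinearMap.adjoint Sl)]
      simp only [ContinuousLinearMap.mul_def, ContinuousLinearMap.adjoint_comp,
        ContinuousLinearMap.adjoint_adjoint, map_sub]
    have h5 : X n = (R n - Rl) * Sl * ContinuousLinearMap.adjoint (T n) +
        Rl * (Sl * (ContinuousLinearMap.adjoint (T n) - ContinuousLinearMap.adjoint Tl)) := by
      simp only [hX]; noncomm_ring
    rw [h5, ← h4]
    refine (norm_add_le _ _).trans (add_le_add ?_ ?_)
    · exact (norm_mul_le _ _).trans (by gcongr; exact hTD' n)
    · exact (norm_mul_le _ _).trans (by gcongr)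
  have hXb : ∀ n j, approxNumber j (X n) ≤ 2 * (C * D) * approxNumber (j / 2) Sl := fun n j => by
    have h1 := approx_sub_half j (R n * Sl * ContinuousLinearMap.adjoint (T n))
      (Rl * Sl * ContinuousLinearMap.adjoint Tl)
    have h2 := approx_mul (j / 2) (R n) Sl _ hC hD (hRC n) (hTD' n)
    have h3 := approx_mul (j / 2) Rl Sl _ hC hD hRlC hTlD'
    simp only [hX]
    linarith
  have hbound : Summable fun j => (2 * (C * D) * approxNumber (j / 2) Sl) ^ p := by
    have h1 := ((hasSum_half hSlmem.2.hasSum).mul_left ((2 * (C * D)) ^ p)).summable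
    refine h1.congr fun j => ?_
    rw [Real.mul_rpow (by positivity) (approx_nonneg _ _)]
  have hXle : ∀ n j, approxNumber j (X n) ^ p ≤ (2 * (C * D) * approxNumber (j / 2) Sl) ^ p :=
    fun n j => Real.rpow_le_rpow (approx_nonneg _ _) (hXb n j) hp0.le
  have hXsum : ∀ n, Summable fun j => approxNumber j (X n) ^ p := fun n =>
    Summable.of_nonneg_of_le (fun j => Real.rpow_nonneg (approx_nonneg _ _) p) (hXle n) hbound
  have hXtend : Tendsto (fun n => ∑' j, approxNumber j (X n) ^ p) atTop (nhds 0) := by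
    have : Tendsto (fun n => ∑' j, approxNumber j (X n) ^ p) atTop (nhds (∑' _ : ℕ, (0 : ℝ))) := by
      refine tendsto_tsum_of_dominated_convergence hbound (fun j => ?_)
        (Eventually.of_forall fun n j => ?_)
      · have h1 : Tendsto (fun n => approxNumber j (X n)) atTop (nhds 0) :=
          squeeze_zero (fun _ => approx_nonneg _ _) (fun n => approx_le_norm _ _) hXnorm
        simpa [Real.zero_rpow hp0.ne'] using h1.rpow_const (p := p) (Or.inr hp0.le)
      · rw [Real.norm_of_nonneg (Real.rpow_nonneg (approx_nonneg _ _) p)]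
        exact hXle n j
    simpa using this
  -- the difference `Sₙ - S`
  have hdsum : ∀ n, Summable fun j => approxNumber j (S n - Sl) ^ p := fun n =>
    (sum_bound hp (fun _ => approx_nonneg _ _) (fun _ => approx_nonneg _ _)
      (fun _ => approx_nonneg _ _) (fun j => approx_sub_half j (S n) Sl)
      (hSmem n).2 hSlmem.2).1
  have hdtend : Tendsto (fun n => ∑' j, approxNumber j (S n - Sl) ^ p) atTop (nhds 0) := by
    have h1 := hS.rpow_const (p := p) (Or.inr hp0.le)
    rw [Real.zero_rpow hp0.ne'] at h1
    refine h1.congr fun n => ?_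
    rw [schattenNorm, ← Real.rpow_mul (tsum_nonneg fun j => Real.rpow_nonneg (approx_nonneg _ _) p),
      one_div_mul_cancel hp0.ne', Real.rpow_one]
  have hscale : ∀ n, HasSum (fun j => (C * D * approxNumber j (S n - Sl)) ^ p)
      ((C * D) ^ p * ∑' j, approxNumber j (S n - Sl) ^ p) := fun n => by
    refine ((hdsum n).hasSum.mul_left ((C * D) ^ p)).congr_fun ?_
    intro j
    rw [Real.mul_rpow (by positivity) (approx_nonneg _ _)]
  have key : ∀ n, ∑' j, approxNumber j (R n * S n * ContinuousLinearMap.adjoint (T n) -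
      Rl * Sl * ContinuousLinearMap.adjoint Tl) ^ p ≤
      2 ^ p * ((C * D) ^ p * ∑' j, approxNumber j (S n - Sl) ^ p +
        ∑' j, approxNumber j (X n) ^ p) := fun n => by
    rw [← (hscale n).tsum_eq]
    refine (sum_bound hp (fun j => ?_) (fun _ => approx_nonneg _ _)
      (fun _ => approx_nonneg _ _) (fun j => ?_) (hscale n).summable (hXsum n)).2
    · exact mul_nonneg (by positivity) (approx_nonneg _ _)
    · have h1 : R n * S n * ContinuousLinearMap.adjoint (T n) -
          Rl * Sl * ContinuousLinearMap.adjoint Tl =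
          R n * (S n - Sl) * ContinuousLinearMap.adjoint (T n) + X n := by
        simp only [hX]; noncomm_ring
      rw [h1]
      exact (approx_add_half j _ _).trans
        (add_le_add (approx_mul _ _ _ _ hC hD (hRC n) (hTD' n)) le_rfl)
  have hlim : Tendsto (fun n => (2 : ℝ) ^ p * ((C * D) ^ p *
      ∑' j, approxNumber j (S n - Sl) ^ p + ∑' j, approxNumber j (X n) ^ p)) atTop (nhds 0) := by
    simpa using ((hdtend.const_mul ((C * D) ^ p)).add hXtend).const_mul ((2 : ℝ) ^ p)
  have hfinal := squeeze_zero
    (fun n => tsum_nonneg fun j => Real.rpow_nonneg (approx_nonneg j _) p) key hlim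
  have h1p : 0 < 1 / p := by positivity
  have := hfinal.rpow_const (p := 1 / p) (Or.inr h1p.le)
  rw [Real.zero_rpow h1p.ne'] at this
  exact this
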